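/- The stationary variance σ_ou² = (1/2) a^{-2H} / sin(πH) of the fractional Ornstein–Uhlenbeck process equals the L² norm of the kernel: ∫_0^∞ K(u)² du = (1/2) a^{-2H} sin(πH)^{-1}, where K(t) = (1/Γ(H+1/2)) [t^{H-1/2} - a ∫_0^t (t-s)^{H-1/2} e^{-as} ds]. -/

import Mathlib

open MeasureTheory Set

lemma aux_image : (fun s : ℝ => 1 / (1 + 2 * s) ^ 2) '' Ioi 0 = Ioo 0 1 := by
  ext v
  simp only [mem_image, mem_Ioi, mem_Ioo]
  constructor
  · rintro ⟨s, hs, rfl⟩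
    refine ⟨by positivity, ?_⟩
    rw [div_lt_one (by positivity)]
    nlinarith
  · rintro ⟨h0, h1⟩
    have hq : 0 < √v := Real.sqrt_pos.2 h0
    have hq1 : √v < 1 := by
      rw [Real.sqrt_lt' one_pos]; simpa using h1
    refine ⟨(1 / √v - 1) / 2, ?_, ?_⟩
    · have : 1 < 1 / √v := by rw [lt_div_iff₀ hq]; linarith
      linarith
    · have : 1 + 2 * ((1 / √v - 1) / 2) = 1 / √v := by ring
      rw [this, div_pow, Real.sq_sqrt h0.le]
      simp

lemma aux_beta (H : ℝ) (h0 : 0 < H) (h1 : H < 1) :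
    ∫⁻ s in Ioi (0:ℝ), ENNReal.ofReal ((s * (s + 1)) ^ (H - 1/2) / (1 + 2 * s) ^ 2)
      = ENNReal.ofReal ((1/4) ^ (H + 1/2) * ProbabilityTheory.beta (1 - H) (H + 1/2)) := by
  have hB := ProbabilityTheory.beta_pos (α := 1 - H) (β := H + 1/2) (by linarith) (by linarith)
  have key := ProbabilityTheory.lintegral_betaPDF_eq_one (α := 1 - H) (β := H + 1/2)
    (by linarith) (by linarith)
  rw [ProbabilityTheory.lintegral_betaPDF, ← aux_image,
    lintegral_image_eq_lintegral_abs_deriv_mul measurableSet_Ioi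
      (f' := fun s => -4 / (1 + 2 * s) ^ 3)] at key
  · rw [← mul_one (ENNReal.ofReal (_ * _)), ← key, ← lintegral_const_mul']
    swap
    · exact ENNReal.ofReal_ne_top
    refine setLIntegral_congr_fun measurableSet_Ioi fun s hs => ?_
    have hs : 0 < s := hs
    have hu : 0 < 1 + 2 * s := by positivity
    rw [← ENNReal.ofReal_mul (by positivity), ← ENNReal.ofReal_mul (by positivity)]
    congr 1
    have e1 : |-4 / (1 + 2 * s) ^ 3| = 4 / (1 + 2 * s) ^ 3 := by
      rw [abs_div, abs_of_pos (by positivity : 0 < (1 + 2 * s) ^ 3)]; norm_num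
    have e2 : 1 - 1 / (1 + 2 * s) ^ 2 = 4 * (s * (s + 1)) * (1 / (1 + 2 * s) ^ 2) := by
      field_simp; ring
    have e3 : (1 / (1 + 2 * s) ^ 2) ^ (1 - H - 1) * (1 / (1 + 2 * s) ^ 2) ^ (H + 1/2 - 1)
        = 1 + 2 * s := by
      rw [← Real.rpow_add (by positivity), one_div, Real.inv_rpow (by positivity),
        ← Real.rpow_neg (by positivity)]
      have e : -(1 - H - 1 + (H + 1/2 - 1)) = 1/2 := by ring
      rw [e, ← Real.sqrt_eq_rpow, Real.sqrt_sq hu.le]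
    have e4 : (1/4 : ℝ) ^ (H + 1/2) * 4 ^ (H + 1/2 - 1) = 1/4 := by
      rw [one_div, Real.inv_rpow (by norm_num), ← Real.rpow_neg (by norm_num),
        ← Real.rpow_add (by norm_num)]
      have : -(H + 1/2) + (H + 1/2 - 1) = -1 := by ring
      rw [this, Real.rpow_neg_one]
    have e5 : H + 1/2 - 1 = H - 1/2 := by ring
    rw [e1, e2, Real.mul_rpow (x := 4 * (s * (s + 1))) (by positivity) (by positivity),
      Real.mul_rpow (x := 4) (y := s * (s + 1)) (by positivity) (by positivity)]
    rw [e5] at e3 e4 ⊢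
    generalize (1 / (1 + 2 * s) ^ 2) ^ (1 - H - 1) = A at *
    generalize (1 / (1 + 2 * s) ^ 2) ^ (H - 1/2) = B at *
    generalize (1/4 : ℝ) ^ (H + 1/2) = X at *
    generalize (4 : ℝ) ^ (H - 1/2) = Y at *
    generalize (s * (s + 1)) ^ (H - 1/2) = Z at *
    generalize ProbabilityTheory.beta (1 - H) (H + 1/2) = W at *
    calc Z / (1 + 2 * s) ^ 2 = (1/4) * (1 + 2 * s) * 4 * Z / (1 + 2 * s) ^ 3 := by field_simp
      _ = (X * Y) * (A * B) * 4 * Z / (1 + 2 * s) ^ 3 := by rw [e4, e3]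
      _ = _ := by field_simp
  · intro s hs
    have hs : 0 < s := hs
    have hu : (1 + 2 * s) ≠ 0 := by positivity
    have h : HasDerivAt (fun s : ℝ => 1 / (1 + 2 * s) ^ 2) (-4 / (1 + 2 * s) ^ 3) s := by
      have h1 : HasDerivAt (fun s : ℝ => (1 + 2 * s) ^ 2) (2 * (1 + 2 * s) * 2) s := by
        have := (((hasDerivAt_id s).const_mul 2).const_add 1).pow 2
        convert! this using 1
        simp
      have := (hasDerivAt_const s (1:ℝ)).div h1 (by positivity)
      convert! this using 1
      field_simp; ring
    exact h.hasDerivWithinAt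
  · intro s hs r hr h
    have hs : 0 < s := hs
    have hr : 0 < r := hr
    simp only [one_div, inv_inj] at h
    have := (pow_left_inj₀ (by positivity) (by positivity) two_ne_zero).1 h
    linarith

noncomputable def aF (H s : ℝ) : ℝ :=
  ((1 + s) ^ (2 * H) + s ^ (2 * H)) / (2 * H) - 2 / H * (s * (s + 1)) ^ (H + 1/2) / (1 + 2 * s)

lemma aux_deriv (H s : ℝ) (h0 : 0 < H) (hs : 0 < s) :
    HasDerivAt (aF H) (((1 + s) ^ (H - 1/2) - s ^ (H - 1/2)) ^ 2 -
      1 / H * ((s * (s + 1)) ^ (H - 1/2) / (1 + 2 * s) ^ 2)) s := by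
  have hs1 : 0 < 1 + s := by positivity
  have hp : 0 < s * (s + 1) := by positivity
  have hu : 0 < 1 + 2 * s := by positivity
  have d1 : HasDerivAt (fun s : ℝ => (1 + s) ^ (2 * H)) (2 * H * (1 + s) ^ (2 * H - 1)) s := by
    have := ((hasDerivAt_id s).const_add 1).rpow_const (p := 2 * H) (Or.inl hs1.ne')
    simpa using this
  have d2 : HasDerivAt (fun s : ℝ => s ^ (2 * H)) (2 * H * s ^ (2 * H - 1)) s := by
    simpa using (hasDerivAt_id s).rpow_const (p := 2 * H) (Or.inl hs.ne')
  have d3 : HasDerivAt (fun s : ℝ => (s * (s + 1)) ^ (H + 1/2))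
      ((2 * s + 1) * (H + 1/2) * (s * (s + 1)) ^ (H + 1/2 - 1)) s := by
    have h : HasDerivAt (fun s : ℝ => s * (s + 1)) (2 * s + 1) s := by
      have := (hasDerivAt_id s).mul ((hasDerivAt_id s).add_const 1)
      convert! this using 1
      simp; ring
    exact h.rpow_const (p := H + 1/2) (Or.inl hp.ne')
  have d4 : HasDerivAt (fun s : ℝ => 1 + 2 * s) 2 s := by
    simpa using ((hasDerivAt_id s).const_mul 2).const_add 1
  have := ((d1.add d2).div_const (2 * H)).sub (((d3.const_mul (2 / H))).div d4 hu.ne')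
  unfold aF
  convert! this using 1
  have e1 : (1 + s) ^ (2 * H - 1) = ((1 + s) ^ (H - 1/2)) ^ 2 := by
    rw [← Real.rpow_mul_natCast hs1.le]; congr 1; push_cast; ring
  have e2 : s ^ (2 * H - 1) = (s ^ (H - 1/2)) ^ 2 := by
    rw [← Real.rpow_mul_natCast hs.le]; congr 1; push_cast; ring
  have e3 : (s * (s + 1)) ^ (H + 1/2 - 1) = s ^ (H - 1/2) * (1 + s) ^ (H - 1/2) := by
    rw [add_comm s 1, ← Real.mul_rpow hs.le hs1.le]; congr 1; ring
  have e4 : (s * (s + 1)) ^ (H + 1/2) = s ^ (H - 1/2) * (1 + s) ^ (H - 1/2) * (s * (s + 1)) := by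
    rw [← e3, ← Real.rpow_add_one hp.ne']; congr 1; ring
  have e5 : (s * (s + 1)) ^ (H - 1/2) = s ^ (H - 1/2) * (1 + s) ^ (H - 1/2) := by
    rw [add_comm s 1, ← Real.mul_rpow hs.le hs1.le]
  rw [e1, e2, e3, e4, e5]
  generalize s ^ (H - 1/2) = x
  generalize (1 + s) ^ (H - 1/2) = y
  field_simp
  ring

lemma aux_lim1 (H c q : ℝ) (h1 : H < 1) :
    Filter.Tendsto (fun w : ℝ => w ^ H * ((1 + c * w⁻¹) ^ H - (1 - 1/4 * w⁻¹) ^ q))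
      Filter.atTop (nhds 0) := by
  have hd : DifferentiableAt ℝ (fun z : ℝ => (1 + c * z) ^ H - (1 - 1/4 * z) ^ q) 0 := by
    apply DifferentiableAt.sub
    · exact DifferentiableAt.rpow_const (by fun_prop) (Or.inl (by simp))
    · exact DifferentiableAt.rpow_const (by fun_prop) (Or.inl (by simp))
  have hO := hd.isBigO_sub
  simp only [mul_zero, add_zero, sub_zero, Real.one_rpow, sub_self] at hO
  have hO2 := hO.comp_tendsto tendsto_inv_atTop_zero
  have hO3 := (Asymptotics.isBigO_refl (fun w : ℝ => w ^ H) Filter.atTop).mul hO2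
  refine hO3.trans_tendsto ?_
  have := tendsto_rpow_neg_atTop (y := 1 - H) (by linarith)
  refine this.congr' ?_
  filter_upwards [Filter.eventually_gt_atTop 0] with w hw
  simp only [Function.comp]
  rw [← Real.rpow_neg_one, ← Real.rpow_add hw]
  congr 1; ring

lemma aux_lim (H : ℝ) (h0 : 0 < H) (h1 : H < 1) :
    Filter.Tendsto (aF H) Filter.atTop (nhds 0) := by
  have hw : Filter.Tendsto (fun s : ℝ => (s + 1/2) ^ 2) Filter.atTop Filter.atTop :=
    (Filter.tendsto_pow_atTop two_ne_zero).comp (Filter.tendsto_atTop_add_const_right _ _ Filter.tendsto_id)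
  have L1 := ((aux_lim1 H (-1/4) (H + 1/2) h1).comp hw).const_mul (1 / H)
  have L2 := ((aux_lim1 H (1/4) (H + 1/2) h1).comp hw).const_mul (1 / H)
  rw [mul_zero] at L1 L2
  have key : ∀ s : ℝ, 0 < s → ∀ c : ℝ, -1/4 ≤ c → (1 / H * (((s + 1/2) ^ 2) ^ H *
      ((1 + c * ((s + 1/2) ^ 2)⁻¹) ^ H - (1 - 1/4 * ((s + 1/2) ^ 2)⁻¹) ^ (H + 1/2))))
      = ((s + 1/2) ^ 2 + c) ^ H / H - 2 / H * (s * (s + 1)) ^ (H + 1/2) / (1 + 2 * s) := by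
    intro s hs c hc
    have hw : 0 < (s + 1/2) ^ 2 := by positivity
    have hw4 : 1 / 4 < (s + 1/2) ^ 2 := by nlinarith
    have a1 : ((s + 1/2) ^ 2 + c) = (s + 1/2) ^ 2 * (1 + c * ((s + 1/2) ^ 2)⁻¹) := by
      field_simp
    have a2 : s * (s + 1) = (s + 1/2) ^ 2 * (1 - 1/4 * ((s + 1/2) ^ 2)⁻¹) := by
      field_simp; ring
    have p1 : 0 ≤ 1 + c * ((s + 1/2) ^ 2)⁻¹ := by
      have : 0 ≤ (s + 1/2) ^ 2 + c := by linarith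
      rw [a1] at this
      exact (mul_nonneg_iff_of_pos_left hw).1 this
    have p2 : 0 ≤ 1 - 1/4 * ((s + 1/2) ^ 2)⁻¹ := by
      have : 0 ≤ s * (s + 1) := by positivity
      rw [a2] at this
      exact (mul_nonneg_iff_of_pos_left hw).1 this
    rw [a1, a2, Real.mul_rpow hw.le p1, Real.mul_rpow hw.le p2, Real.rpow_add hw H,
      ← Real.sqrt_eq_rpow, Real.sqrt_sq (by positivity)]
    generalize (1 - 1/4 * ((s + 1/2) ^ 2)⁻¹) ^ (H + 1/2) = A
    generalize (1 + c * ((s + 1/2) ^ 2)⁻¹) ^ H = B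
    generalize ((s + 1/2) ^ 2) ^ H = D
    field_simp
    ring
  refine tendsto_of_tendsto_of_tendsto_of_le_of_le' L1 L2 ?_ ?_
  · filter_upwards [Filter.eventually_gt_atTop 0] with s hs
    simp only [Function.comp]
    rw [key s hs _ le_rfl, aF]
    refine sub_le_sub_right ?_ _
    rw [div_le_div_iff₀ h0 (by positivity)]
    have : (s + 1/2) ^ 2 + -1/4 = s * (s + 1) := by ring
    rw [this, Real.mul_rpow hs.le (by positivity), mul_comm 2 H,
      Real.rpow_mul (by positivity), Real.rpow_mul hs.le, Real.rpow_two, Real.rpow_two, add_comm 1 s]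
    nlinarith [sq_nonneg ((s + 1) ^ H - s ^ H)]
  · filter_upwards [Filter.eventually_gt_atTop 0] with s hs
    simp only [Function.comp]
    rw [key s hs _ (by norm_num), aF]
    refine sub_le_sub_right ?_ _
    rw [div_le_div_iff₀ (by positivity) h0]
    have hc := And.right (Real.concaveOn_rpow h0.le h1.le) (sq_nonneg (1 + s) : (1 + s) ^ 2 ∈ Ici 0)
      (sq_nonneg s : s ^ 2 ∈ Ici 0) (by norm_num : (0:ℝ) ≤ 1/2) (by norm_num : (0:ℝ) ≤ 1/2)
      (by norm_num)
    simp only [smul_eq_mul] at hc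
    have : 1 / 2 * (1 + s) ^ 2 + 1 / 2 * s ^ 2 = (s + 1/2) ^ 2 + 1/4 := by ring
    rw [this] at hc
    rw [Real.rpow_mul (by positivity), Real.rpow_mul hs.le, Real.rpow_two, Real.rpow_two]
    nlinarith

lemma aux_J (H : ℝ) (h0 : 0 < H) (h1 : H < 1) :
    ∫⁻ s in Ioi (0:ℝ), ENNReal.ofReal (((1 + s) ^ (H - 1/2) - s ^ (H - 1/2)) ^ 2)
      = ENNReal.ofReal ((1/4) ^ (H + 1/2) * ProbabilityTheory.beta (1 - H) (H + 1/2) / H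
        - 1 / (2 * H)) ∧
      0 ≤ (1/4) ^ (H + 1/2) * ProbabilityTheory.beta (1 - H) (H + 1/2) / H - 1 / (2 * H) := by
  have hB := ProbabilityTheory.beta_pos (α := 1 - H) (β := H + 1/2) (by linarith) (by linarith)
  have hbeta := aux_beta H h0 h1
  set D : ℝ := (1/4) ^ (H + 1/2) * ProbabilityTheory.beta (1 - H) (H + 1/2) with hD
  set b : ℝ → ℝ := fun s => (s * (s + 1)) ^ (H - 1/2) / (1 + 2 * s) ^ 2 with hb
  have hbm : Measurable b := by fun_prop
  have hb0 : ∀ s ∈ Ioi (0:ℝ), 0 ≤ b s := fun s hs => by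
    have : 0 < s := hs
    simp only [hb]; positivity
  have hbi : IntegrableOn b (Ioi 0) := by
    refine ⟨hbm.aestronglyMeasurable, ?_⟩
    rw [hasFiniteIntegral_iff_ofReal (ae_restrict_of_forall_mem measurableSet_Ioi hb0), hbeta]
    exact ENNReal.ofReal_lt_top
  have hbint : ∫ s in Ioi 0, b s = D := by
    rw [integral_eq_lintegral_of_nonneg_ae (ae_restrict_of_forall_mem measurableSet_Ioi hb0)
      hbm.aestronglyMeasurable, hbeta, ENNReal.toReal_ofReal (by positivity)]
  set b' : ℝ → ℝ := (Ioi (0:ℝ)).indicator b with hb'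
  have hb'i : Integrable b' := hbi.integrable_indicator measurableSet_Ioi
  have hcont : Continuous fun s => ∫ x in (0:ℝ)..s, b' x :=
    intervalIntegral.continuous_primitive (fun _ _ => hb'i.intervalIntegrable) 0
  have hlim : Filter.Tendsto (fun s => ∫ x in (0:ℝ)..s, b' x) Filter.atTop (nhds D) := by
    have := intervalIntegral_tendsto_integral_Ioi 0 hb'i.integrableOn Filter.tendsto_id
    rw [setIntegral_indicator measurableSet_Ioi, inter_self, hbint] at this
    exact this
  have hder : ∀ s : ℝ, 0 < s → HasDerivAt (fun s => ∫ x in (0:ℝ)..s, b' x) (b s) s := by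
    intro s hs
    have hev : b' =ᶠ[nhds s] b := by
      filter_upwards [Ioi_mem_nhds hs] with x hx
      exact indicator_of_mem hx _
    have hbc : ContinuousAt b s := by
      simp only [hb]
      refine ContinuousAt.div ?_ (by fun_prop) (by positivity)
      exact ContinuousAt.rpow_const (by fun_prop) (Or.inl (by positivity))
    have := intervalIntegral.integral_hasDerivAt_right (a := 0) (b := s) (f := b')
      hb'i.intervalIntegrable
      (hb'i.aestronglyMeasurable.stronglyMeasurableAtFilter) (hbc.congr hev.symm)
    rwa [hev.eq_of_nhds] at this
  set g : ℝ → ℝ := fun s => aF H s + 1 / H * ∫ x in (0:ℝ)..s, b' x with hg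
  have hgc : ContinuousWithinAt g (Ici 0) 0 := by
    have : ContinuousAt (aF H) 0 := by
      unfold aF
      refine ContinuousAt.sub ?_ (ContinuousAt.div ?_ (by fun_prop) (by norm_num))
      · refine ContinuousAt.div_const (ContinuousAt.add ?_ ?_) _
        · exact ContinuousAt.rpow_const (by fun_prop) (Or.inl (by norm_num))
        · exact ContinuousAt.rpow_const (by fun_prop) (Or.inr (by positivity))
      · refine ContinuousAt.mul (by fun_prop) ?_
        exact ContinuousAt.rpow_const (by fun_prop) (Or.inr (by positivity))
    exact (this.add (continuousAt_const.mul hcont.continuousAt)).continuousWithinAt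
  have hgd : ∀ s ∈ Ioi (0:ℝ), HasDerivAt g (((1 + s) ^ (H - 1/2) - s ^ (H - 1/2)) ^ 2) s := by
    intro s hs
    have := (aux_deriv H s h0 hs).add ((hder s hs).const_mul (1 / H))
    convert! this using 1
    simp only [hb]; ring
  have hgl : Filter.Tendsto g Filter.atTop (nhds (0 + 1 / H * D)) :=
    (aux_lim H h0 h1).add (hlim.const_mul _)
  have hnn : ∀ s ∈ Ioi (0:ℝ), 0 ≤ ((1 + s) ^ (H - 1/2) - s ^ (H - 1/2)) ^ 2 :=
    fun s _ => sq_nonneg _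
  have r1 := integrableOn_Ioi_deriv_of_nonneg hgc hgd hnn hgl
  have r2 := integral_Ioi_of_hasDerivAt_of_nonneg hgc hgd hnn hgl
  have : g 0 = 1 / (2 * H) := by
    simp only [hg, aF]
    rw [Real.zero_rpow (by positivity), zero_mul, Real.zero_rpow (by positivity)]
    simp
  have r3 : 0 + 1 / H * D - g 0 = D / H - 1 / (2 * H) := by rw [this]; ring
  rw [r3] at r2
  rw [← ofReal_integral_eq_lintegral_ofReal r1 (ae_restrict_of_forall_mem measurableSet_Ioi hnn), r2]
  refine ⟨rfl, ?_⟩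
  rw [← r2]
  exact setIntegral_nonneg measurableSet_Ioi hnn

/-- truncated power -/
noncomputable def pp (H x : ℝ) : ℝ := if 0 < x then x ^ (H - 1/2) else 0

lemma pp_meas (H : ℝ) : Measurable (pp H) :=
  Measurable.ite measurableSet_Ioi (by fun_prop) (by fun_prop)

noncomputable def CC (H : ℝ) : ℝ :=
  (1/4) ^ (H + 1/2) * ProbabilityTheory.beta (1 - H) (H + 1/2) / H

lemma CC_pos (H : ℝ) (h0 : 0 < H) (h1 : H < 1) : 0 < CC H := by
  have hB := ProbabilityTheory.beta_pos (α := 1 - H) (β := H + 1/2) (by linarith) (by linarith)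
  unfold CC; positivity

lemma aux_C1 (H : ℝ) (h0 : 0 < H) (h1 : H < 1) :
    ∫⁻ x, ENNReal.ofReal ((pp H (x + 1) - pp H x) ^ 2) = ENNReal.ofReal (CC H) := by
  have hm := pp_meas H
  have i1 : ∫⁻ x in Iic (-1:ℝ), ENNReal.ofReal ((pp H (x + 1) - pp H x) ^ 2) = 0 := by
    refine setLIntegral_eq_zero measurableSet_Iic fun x (hx : x ≤ -1) => ?_
    simp [pp, show ¬ (0 < x + 1) by linarith, show ¬ (0 < x) by linarith]
  have i2 : ∫⁻ x in Ioc (-1:ℝ) 0, ENNReal.ofReal ((pp H (x + 1) - pp H x) ^ 2)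
      = ENNReal.ofReal (1 / (2 * H)) := by
    have e : ∫⁻ x in Ioc (-1:ℝ) 0, ENNReal.ofReal ((pp H (x + 1) - pp H x) ^ 2) =
        ∫⁻ x in Ioc (-1:ℝ) 0, ENNReal.ofReal ((x + 1) ^ (2 * H - 1)) := by
      refine setLIntegral_congr_fun measurableSet_Ioc fun x hx => ?_
      have h : 0 < x + 1 := by linarith [hx.1]
      simp only [pp, h, if_true, show ¬ (0 < x) from not_lt.2 hx.2, if_false, sub_zero]
      rw [← Real.rpow_mul_natCast h.le]; congr 2; push_cast; ring
    have hi : IntervalIntegrable (fun x : ℝ => (x + 1) ^ (2 * H - 1)) volume (-1) 0 := by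
      have := (intervalIntegral.intervalIntegrable_rpow' (a := 0) (b := 1)
        (r := 2 * H - 1) (by linarith)).comp_add_right 1
      simpa using this
    rw [e, ← ofReal_integral_eq_lintegral_ofReal
      ((intervalIntegrable_iff_integrableOn_Ioc_of_le (by norm_num)).1 hi)
      (ae_restrict_of_forall_mem measurableSet_Ioc fun x hx =>
        Real.rpow_nonneg (by linarith [hx.1]) _),
      ← intervalIntegral.integral_of_le (by norm_num),
      intervalIntegral.integral_comp_add_right (fun x : ℝ => x ^ (2 * H - 1)),
      integral_rpow (Or.inl (by linarith))]
    norm_num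
    rw [Real.zero_rpow (by positivity)]; simp
  have i3 : ∫⁻ x in Ioi (0:ℝ), ENNReal.ofReal ((pp H (x + 1) - pp H x) ^ 2)
      = ENNReal.ofReal (CC H - 1 / (2 * H)) := by
    rw [CC, ← (aux_J H h0 h1).1]
    refine setLIntegral_congr_fun measurableSet_Ioi fun x (hx : 0 < x) => ?_
    simp only [pp, hx, show 0 < 1 + x by linarith, if_true, add_comm x 1]
  have hge : 0 ≤ CC H - 1 / (2 * H) := (aux_J H h0 h1).2
  have hu : (univ : Set ℝ) = Iic (-1) ∪ (Ioc (-1) 0 ∪ Ioi 0) := by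
    rw [Ioc_union_Ioi_eq_Ioi (by norm_num), Iic_union_Ioi]
  rw [← setLIntegral_univ, hu, lintegral_union (by measurability), i1, lintegral_union (by measurability), i2, i3, zero_add,
    ← ENNReal.ofReal_add (by positivity) hge]
  · congr 1; ring
  · rw [Set.disjoint_left]; intro x h1 h2; exact absurd h1.2 (not_le.2 h2)
  · rw [Ioc_union_Ioi_eq_Ioi (by norm_num)]; exact Set.Iic_disjoint_Ioi le_rfl

lemma aux_Ch (H : ℝ) (h0 : 0 < H) (h1 : H < 1) (h : ℝ) (hh : 0 < h) :
    ∫⁻ x, ENNReal.ofReal ((pp H (x + h) - pp H x) ^ 2) = ENNReal.ofReal (CC H * h ^ (2 * H)) := by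
  have hm := pp_meas H
  have e := Real.map_volume_mul_left hh.ne'
  have e2 : ∫⁻ x, ENNReal.ofReal ((pp H (x + h) - pp H x) ^ 2)
      ∂(ENNReal.ofReal |h⁻¹| • volume) = ∫⁻ x, ENNReal.ofReal ((pp H (h * x + h) - pp H (h * x)) ^ 2) := by
    rw [← e, lintegral_map (by fun_prop) (by fun_prop)]
  have hs : ∀ x, pp H (h * x) = h ^ (H - 1/2) * pp H x := by
    intro x
    unfold pp
    by_cases hx : 0 < x
    · rw [if_pos (by positivity), if_pos hx, Real.mul_rpow hh.le hx.le]
    · rw [if_neg hx, if_neg (fun h' => hx ((mul_pos_iff_of_pos_left hh).1 h')), mul_zero]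
  have e3 : ∀ x, ENNReal.ofReal ((pp H (h * x + h) - pp H (h * x)) ^ 2)
      = ENNReal.ofReal (h ^ (2 * H - 1)) * ENNReal.ofReal ((pp H (x + 1) - pp H x) ^ 2) := by
    intro x
    rw [← ENNReal.ofReal_mul (by positivity), show h * x + h = h * (x + 1) by ring, hs, hs]
    congr 1
    have : h ^ (2 * H - 1) = (h ^ (H - 1/2)) ^ 2 := by
      rw [← Real.rpow_mul_natCast hh.le]; congr 1; push_cast; ring
    rw [this]; ring
  simp_rw [e3] at e2
  rw [lintegral_smul_measure, lintegral_const_mul' _ _ ENNReal.ofReal_ne_top, aux_C1 H h0 h1,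
    abs_of_pos (by positivity), smul_eq_mul] at e2
  have hne : ENNReal.ofReal h * ENNReal.ofReal h⁻¹ = 1 := by
    rw [← ENNReal.ofReal_mul hh.le, mul_inv_cancel₀ hh.ne', ENNReal.ofReal_one]
  have := CC_pos H h0 h1
  rw [← one_mul (lintegral _ _), ← hne, mul_assoc, e2, ← ENNReal.ofReal_mul (by positivity),
    ← ENNReal.ofReal_mul (by positivity)]
  congr 1
  rw [Real.rpow_sub_one hh.ne']
  field_simp

lemma aux_Csr (H : ℝ) (h0 : 0 < H) (h1 : H < 1) (s r : ℝ) :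
    ∫⁻ t, ENNReal.ofReal ((pp H (t - s) - pp H (t - r)) ^ 2)
      = ENNReal.ofReal (CC H * |s - r| ^ (2 * H)) := by
  wlog hsr : s ≤ r generalizing s r
  · rw [abs_sub_comm, ← this r s (le_of_not_ge hsr)]
    congr 1; ext t; congr 1; ring
  rcases hsr.eq_or_lt with rfl | hlt
  · simp [Real.zero_rpow (show 2 * H ≠ 0 by positivity)]
  rw [abs_sub_comm, abs_of_pos (sub_pos.2 hlt), ← aux_Ch H h0 h1 _ (sub_pos.2 hlt),
    ← lintegral_sub_right_eq_self (fun x => ENNReal.ofReal ((pp H (x + (r - s)) - pp H x) ^ 2)) r]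
  congr 1; ext t; congr 4; ring

/-- exponential law -/
noncomputable def mu (a : ℝ) : Measure ℝ :=
  (volume.restrict (Ioi 0)).withDensity fun s => ENNReal.ofReal (a * Real.exp (-a * s))

lemma lint_mu (a : ℝ) (f : ℝ → ENNReal) (hf : Measurable f) :
    ∫⁻ s, f s ∂(mu a) = ∫⁻ s in Ioi 0, ENNReal.ofReal (a * Real.exp (-a * s)) * f s := by
  rw [mu, lintegral_withDensity_eq_lintegral_mul _ (by fun_prop) hf]
  rfl

lemma mom_mu (a q : ℝ) (ha : 0 < a) (hq : 0 ≤ q) :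
    ∫⁻ s in Ioi 0, ENNReal.ofReal (a * Real.exp (-a * s)) * ENNReal.ofReal (s ^ q)
      = ENNReal.ofReal (a ^ (-q) * Real.Gamma (q + 1)) := by
  have h := Real.integral_rpow_mul_exp_neg_mul_Ioi (a := q + 1) (r := a) (by linarith) ha
  have hG : 0 < Real.Gamma (q + 1) := Real.Gamma_pos_of_pos (by linarith)
  have hi : IntegrableOn (fun t : ℝ => t ^ (q + 1 - 1) * Real.exp (-(a * t))) (Ioi 0) := by
    by_contra hc
    rw [integral_undef hc] at h
    have : 0 < (1 / a) ^ (q + 1) * Real.Gamma (q + 1) := by positivity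
    linarith
  have e : ∀ s ∈ Ioi (0:ℝ), ENNReal.ofReal (a * Real.exp (-a * s)) * ENNReal.ofReal (s ^ q)
      = ENNReal.ofReal (a * (s ^ (q + 1 - 1) * Real.exp (-(a * s)))) := by
    intro s hs
    rw [← ENNReal.ofReal_mul (by positivity)]
    congr 1
    rw [add_sub_cancel_right, neg_mul]; ring
  rw [setLIntegral_congr_fun measurableSet_Ioi e, ← ofReal_integral_eq_lintegral_ofReal
    (hi.const_mul a) (ae_restrict_of_forall_mem measurableSet_Ioi fun s hs => by
      have : 0 < s := hs
      positivity), integral_const_mul, h]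
  congr 1
  rw [one_div, Real.inv_rpow ha.le, ← Real.rpow_neg ha.le, neg_add, Real.rpow_add ha,
    Real.rpow_neg_one]
  field_simp

lemma mu_prob (a : ℝ) (ha : 0 < a) : IsProbabilityMeasure (mu a) := by
  refine ⟨?_⟩
  rw [← lintegral_one, lint_mu a _ (by fun_prop)]
  simpa using mom_mu a 0 ha le_rfl

lemma half_mom (a q : ℝ) (ha : 0 < a) (hq : 0 ≤ q) :
    ∫⁻ s, ∫⁻ r, (if s < r then ENNReal.ofReal ((r - s) ^ q) else 0) ∂(mu a) ∂(mu a)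
      = ENNReal.ofReal (1/2) * ENNReal.ofReal (a ^ (-q) * Real.Gamma (q + 1)) := by
  have hprob := mu_prob a ha
  have hm : Measurable (fun z : ℝ × ℝ =>
      if z.1 < z.2 then ENNReal.ofReal ((z.2 - z.1) ^ q) else 0) :=
    Measurable.ite (measurableSet_lt measurable_fst measurable_snd) (by fun_prop) (by fun_prop)
  have hin : ∀ s ∈ Ioi (0:ℝ), ∫⁻ r, (if s < r then ENNReal.ofReal ((r - s) ^ q) else 0) ∂(mu a)
      = ENNReal.ofReal (Real.exp (-a * s)) * ENNReal.ofReal (a ^ (-q) * Real.Gamma (q + 1)) := by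
    intro s (hs : 0 < s)
    have hms : Measurable fun r : ℝ => if s < r then ENNReal.ofReal ((r - s) ^ q) else 0 :=
      hm.comp (measurable_const.prodMk measurable_id)
    rw [lint_mu a _ hms,
      ← lintegral_indicator measurableSet_Ioi, ← lintegral_add_right_eq_self _ s,
      ← mom_mu a q ha hq, ← lintegral_const_mul' _ _ ENNReal.ofReal_ne_top,
      ← lintegral_indicator measurableSet_Ioi]
    congr 1; ext x
    by_cases hx : 0 < x
    · rw [indicator_of_mem (show x + s ∈ Ioi 0 from by simp; linarith),
        indicator_of_mem (show x ∈ Ioi 0 from hx), if_pos (by linarith), add_sub_cancel_right,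
        ← mul_assoc]
      repeat rw [← ENNReal.ofReal_mul (by positivity)]
      congr 1
      rw [mul_add, Real.exp_add]; ring
    · rw [indicator_of_notMem (show x ∉ Ioi 0 from hx)]
      by_cases hxs : x + s ∈ Ioi 0
      · rw [indicator_of_mem hxs, if_neg (by linarith), mul_zero]
      · rw [indicator_of_notMem hxs]
  rw [lint_mu a _ (Measurable.lintegral_prod_right' hm),
    setLIntegral_congr_fun measurableSet_Ioi (fun s hs => by rw [hin s hs])]
  have e : ∀ s ∈ Ioi (0:ℝ), ENNReal.ofReal (a * Real.exp (-a * s)) *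
      (ENNReal.ofReal (Real.exp (-a * s)) * ENNReal.ofReal (a ^ (-q) * Real.Gamma (q + 1)))
      = (ENNReal.ofReal (1/2) * ENNReal.ofReal (a ^ (-q) * Real.Gamma (q + 1))) *
        (ENNReal.ofReal ((2 * a) * Real.exp (-(2 * a) * s)) * ENNReal.ofReal (s ^ (0:ℝ))) := by
    intro s hs
    rw [Real.rpow_zero, ENNReal.ofReal_one, mul_one]
    have hG : 0 < Real.Gamma (q + 1) := Real.Gamma_pos_of_pos (by linarith)
    repeat rw [← ENNReal.ofReal_mul (by positivity)]
    congr 1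
    rw [show -(2 * a) * s = -a * s + -a * s by ring, Real.exp_add]; ring
  rw [setLIntegral_congr_fun measurableSet_Ioi e, lintegral_const_mul' _ _ (by finiteness),
    mom_mu (2 * a) 0 (by positivity) le_rfl]
  simp

lemma full_mom (a q : ℝ) (ha : 0 < a) (hq : 0 < q) :
    ∫⁻ s, ∫⁻ r, ENNReal.ofReal (|s - r| ^ q) ∂(mu a) ∂(mu a)
      = ENNReal.ofReal (a ^ (-q) * Real.Gamma (q + 1)) := by
  have hprob := mu_prob a ha
  have hm : Measurable (fun z : ℝ × ℝ =>
      if z.1 < z.2 then ENNReal.ofReal ((z.2 - z.1) ^ q) else 0) :=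
    Measurable.ite (measurableSet_lt measurable_fst measurable_snd) (by fun_prop) (by fun_prop)
  have e : ∀ s r : ℝ, ENNReal.ofReal (|s - r| ^ q) =
      (if s < r then ENNReal.ofReal ((r - s) ^ q) else 0) +
      (if r < s then ENNReal.ofReal ((s - r) ^ q) else 0) := by
    intro s r
    rcases lt_trichotomy s r with h | rfl | h
    · rw [if_pos h, if_neg h.le.not_gt, add_zero, abs_sub_comm, abs_of_pos (sub_pos.2 h)]
    · simp [Real.zero_rpow hq.ne']
    · rw [if_pos h, if_neg h.le.not_gt, zero_add, abs_of_pos (sub_pos.2 h)]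
  simp_rw [e]
  have s1 : ∀ s : ℝ, Measurable fun r : ℝ => if s < r then ENNReal.ofReal ((r - s) ^ q) else 0 :=
    fun s => hm.comp (measurable_const.prodMk measurable_id)
  simp_rw [fun s => lintegral_add_left (μ := mu a) (s1 s)
    (fun r => if r < s then ENNReal.ofReal ((s - r) ^ q) else 0)]
  rw [lintegral_add_left (Measurable.lintegral_prod_right' hm)]
  have hsw : ∫⁻ s, ∫⁻ r, (if r < s then ENNReal.ofReal ((s - r) ^ q) else 0) ∂(mu a) ∂(mu a)
      = ∫⁻ r, ∫⁻ s, (if r < s then ENNReal.ofReal ((s - r) ^ q) else 0) ∂(mu a) ∂(mu a) :=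
    lintegral_lintegral_swap (hm.comp measurable_swap).aemeasurable
  rw [hsw, half_mom a q ha hq.le, ← add_mul, ← ENNReal.ofReal_add (by norm_num) (by norm_num)]
  norm_num

lemma var_id {μ : Measure ℝ} [IsProbabilityMeasure μ] (X : ℝ → ℝ) (hX : Measurable X)
    (hf : ∫⁻ s, ENNReal.ofReal (X s ^ 2) ∂μ < ⊤) :
    Integrable X μ ∧ 2 * ENNReal.ofReal ((∫ s, X s ∂μ) ^ 2) +
      ∫⁻ s, ∫⁻ r, ENNReal.ofReal ((X s - X r) ^ 2) ∂μ ∂μ = 2 * ∫⁻ s, ENNReal.ofReal (X s ^ 2) ∂μ := by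
  have hsq : Integrable (fun s => X s ^ 2) μ := by
    refine ⟨(hX.pow_const 2).aestronglyMeasurable, ?_⟩
    rwa [hasFiniteIntegral_iff_ofReal (Filter.Eventually.of_forall fun s => sq_nonneg _)]
  have hL : MemLp X 2 μ := (memLp_two_iff_integrable_sq hX.aestronglyMeasurable).2 hsq
  have hi : Integrable X μ := hL.integrable (by norm_num)
  refine ⟨hi, ?_⟩
  set m := ∫ s, X s ∂μ
  set v := ∫ s, X s ^ 2 ∂μ
  have hin1 : ∀ s, Integrable (fun r => (X s - X r) ^ 2) μ := fun s => by
    have : (fun r => (X s - X r) ^ 2) = fun r => X s ^ 2 - 2 * X s * X r + X r ^ 2 := by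
      ext r; ring
    rw [this]
    exact ((integrable_const _).sub (hi.const_mul _)).add hsq
  have hin : ∀ s, ∫ r, (X s - X r) ^ 2 ∂μ = X s ^ 2 - 2 * m * X s + v := fun s => by
    have : (fun r => (X s - X r) ^ 2) = fun r => X s ^ 2 - 2 * X s * X r + X r ^ 2 := by
      ext r; ring
    have h3 : Integrable (fun r => X s ^ 2 - 2 * X s * X r) μ :=
      (integrable_const _).sub (hi.const_mul _)
    rw [this, integral_add h3 hsq,
      integral_sub (integrable_const _) (hi.const_mul _), integral_const_mul]
    simp only [integral_const, probReal_univ, smul_eq_mul, one_mul]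
    ring
  have hin2 : ∀ s, ∫⁻ r, ENNReal.ofReal ((X s - X r) ^ 2) ∂μ
      = ENNReal.ofReal (X s ^ 2 - 2 * m * X s + v) := fun s => by
    rw [← hin, ofReal_integral_eq_lintegral_ofReal (hin1 s)
      (Filter.Eventually.of_forall fun r => sq_nonneg _)]
  have hnn : ∀ s, 0 ≤ X s ^ 2 - 2 * m * X s + v := fun s => by
    rw [← hin]; exact integral_nonneg fun r => sq_nonneg _
  have hout : Integrable (fun s => X s ^ 2 - 2 * m * X s + v) μ :=
    (hsq.sub (hi.const_mul _)).add (integrable_const _)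
  have hI : ∫ s, (X s ^ 2 - 2 * m * X s + v) ∂μ = 2 * v - 2 * m ^ 2 := by
    have h3 : Integrable (fun s => X s ^ 2 - 2 * m * X s) μ := hsq.sub (hi.const_mul _)
    rw [integral_add h3 (integrable_const _),
      integral_sub hsq (hi.const_mul _), integral_const_mul]
    simp only [integral_const, probReal_univ, smul_eq_mul, one_mul]
    ring
  have hI0 : 0 ≤ 2 * v - 2 * m ^ 2 := by rw [← hI]; exact integral_nonneg hnn
  simp_rw [hin2]
  rw [← ofReal_integral_eq_lintegral_ofReal hout (Filter.Eventually.of_forall hnn), hI,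
    ← ofReal_integral_eq_lintegral_ofReal hsq (Filter.Eventually.of_forall fun s => sq_nonneg _)]
  have h2 : (2 : ENNReal) = ENNReal.ofReal 2 := by simp
  rw [h2, ← ENNReal.ofReal_mul (by norm_num), ← ENNReal.ofReal_mul (by norm_num),
    ← ENNReal.ofReal_add (by positivity) hI0]
  congr 1
  simp only [v]; ring

lemma main_k (H a : ℝ) (h0 : 0 < H) (h1 : H < 1) (ha : 0 < a) :
    (∀ᵐ t : ℝ, Integrable (fun s => pp H (t - s) - pp H t) (mu a)) ∧
    ∫⁻ t, ENNReal.ofReal ((∫ s, (pp H (t - s) - pp H t) ∂(mu a)) ^ 2)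
      = ENNReal.ofReal (CC H * (a ^ (-(2 * H)) * Real.Gamma (2 * H + 1)) / 2) := by
  have hprob := mu_prob a ha
  have hpm := pp_meas H
  have hC := CC_pos H h0 h1
  have hG : 0 < Real.Gamma (2 * H + 1) := Real.Gamma_pos_of_pos (by linarith)
  set M := a ^ (-(2 * H)) * Real.Gamma (2 * H + 1) with hM
  have hM0 : 0 < M := by positivity
  have mA : Measurable (fun z : ℝ × ℝ => ENNReal.ofReal ((pp H (z.1 - z.2) - pp H z.1) ^ 2)) := by
    fun_prop
  have A1 : ∫⁻ t, ∫⁻ s, ENNReal.ofReal ((pp H (t - s) - pp H t) ^ 2) ∂(mu a)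
      = ENNReal.ofReal (CC H * M) := by
    rw [lintegral_lintegral_swap mA.aemeasurable]
    have : ∀ s, ∫⁻ t, ENNReal.ofReal ((pp H (t - s) - pp H t) ^ 2)
        = ENNReal.ofReal (CC H) * ENNReal.ofReal (|s| ^ (2 * H)) := fun s => by
      have := aux_Csr H h0 h1 s 0
      simp only [sub_zero] at this
      rw [this, ENNReal.ofReal_mul hC.le]
    simp_rw [this]
    rw [lintegral_const_mul' _ _ ENNReal.ofReal_ne_top, lint_mu a _ (by fun_prop),
      setLIntegral_congr_fun (g := fun s => ENNReal.ofReal (a * Real.exp (-a * s)) *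
        ENNReal.ofReal (s ^ (2 * H))) measurableSet_Ioi
        (fun s (hs : 0 < s) => by simp only [abs_of_pos hs]),
      mom_mu a _ ha (by positivity), ENNReal.ofReal_mul hC.le]
  have A2 : ∫⁻ t, ∫⁻ s, ∫⁻ r, ENNReal.ofReal (((pp H (t - s) - pp H t) - (pp H (t - r) - pp H t)) ^ 2)
      ∂(mu a) ∂(mu a) = ENNReal.ofReal (CC H * M) := by
    have m3 : Measurable (fun z : (ℝ × ℝ) × ℝ =>
        ENNReal.ofReal ((pp H (z.1.1 - z.1.2) - pp H (z.1.1 - z.2)) ^ 2)) := by fun_prop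
    simp_rw [sub_sub_sub_cancel_right]
    rw [lintegral_lintegral_swap (Measurable.lintegral_prod_right' m3).aemeasurable]
    have : ∀ s, ∫⁻ t, ∫⁻ r, ENNReal.ofReal ((pp H (t - s) - pp H (t - r)) ^ 2) ∂(mu a)
        = ENNReal.ofReal (CC H) * ∫⁻ r, ENNReal.ofReal (|s - r| ^ (2 * H)) ∂(mu a) := fun s => by
      rw [lintegral_lintegral_swap (Measurable.aemeasurable (by fun_prop)),
        ← lintegral_const_mul' _ _ ENNReal.ofReal_ne_top]
      congr 1; ext r
      rw [aux_Csr H h0 h1, ENNReal.ofReal_mul hC.le]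
    simp_rw [this]
    rw [lintegral_const_mul' _ _ ENNReal.ofReal_ne_top, full_mom a _ ha (by positivity),
      ENNReal.ofReal_mul hC.le]
  have hae : ∀ᵐ t : ℝ, ∫⁻ s, ENNReal.ofReal ((pp H (t - s) - pp H t) ^ 2) ∂(mu a) < ⊤ :=
    ae_lt_top (Measurable.lintegral_prod_right' mA) (by rw [A1]; exact ENNReal.ofReal_ne_top)
  have hX : ∀ t, Measurable fun s => pp H (t - s) - pp H t := fun t => by fun_prop
  refine ⟨hae.mono fun t ht => (var_id _ (hX t) ht).1, ?_⟩
  have hkm : Measurable fun t => ∫ s, (pp H (t - s) - pp H t) ∂(mu a) := by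
    have : StronglyMeasurable (fun z : ℝ × ℝ => pp H (z.1 - z.2) - pp H z.1) :=
      Measurable.stronglyMeasurable (by fun_prop)
    exact (this.integral_prod_right' (ν := mu a)).measurable
  have key := lintegral_congr_ae (hae.mono fun t ht => (var_id _ (hX t) ht).2)
  rw [lintegral_add_left (by fun_prop), lintegral_const_mul' _ _ (by simp),
    lintegral_const_mul' _ _ (by simp), A1, A2] at key
  have h2 : (2 : ENNReal) = ENNReal.ofReal 2 := by simp
  have key2 : 2 * ∫⁻ t, ENNReal.ofReal ((∫ s, (pp H (t - s) - pp H t) ∂(mu a)) ^ 2)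
      = ENNReal.ofReal (CC H * M) := by
    rw [two_mul (ENNReal.ofReal (CC H * M))] at key
    exact (ENNReal.add_left_inj ENNReal.ofReal_ne_top).1 key
  have : ENNReal.ofReal (CC H * M) = 2 * ENNReal.ofReal (CC H * M / 2) := by
    rw [h2, ← ENNReal.ofReal_mul (by norm_num)]; congr 1; ring
  rw [this] at key2
  exact (ENNReal.mul_right_inj (by simp) (by simp)).1 key2

lemma gam (H a : ℝ) (h0 : 0 < H) (h1 : H < 1) (ha : 0 < a) :
    (1 / Real.Gamma (H + 1/2)) ^ 2 * (CC H * (a ^ (-(2 * H)) * Real.Gamma (2 * H + 1)) / 2)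
      = a ^ (-(2 * H)) / (2 * Real.sin (Real.pi * H)) := by
  have g1 := Real.Gamma_mul_Gamma_one_sub H
  have g2 := Real.Gamma_mul_Gamma_add_half H
  have g3 : Real.Gamma (2 * H + 1) = 2 * H * Real.Gamma (2 * H) :=
    Real.Gamma_add_one (by positivity)
  have g4 : Real.Gamma (1 - H + (H + 1/2)) = √Real.pi / 2 := by
    rw [show 1 - H + (H + 1/2) = 1/2 + 1 by ring, Real.Gamma_add_one (by norm_num),
      Real.Gamma_one_half_eq]; ring
  have g5 : (1/4 : ℝ) ^ (H + 1/2) = 2 ^ (1 - 2 * H) / 4 := by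
    rw [show (1/4 : ℝ) = 2 ^ (-2 : ℝ) by rw [Real.rpow_neg (by norm_num)]; norm_num,
      ← Real.rpow_mul (by norm_num), show (-2 : ℝ) * (H + 1/2) = (1 - 2 * H) + (-2) by ring,
      Real.rpow_add (by norm_num), Real.rpow_neg (by norm_num) 2]
    norm_num
    ring
  have hs : 0 < Real.sin (Real.pi * H) :=
    Real.sin_pos_of_pos_of_lt_pi (by positivity) (by nlinarith [Real.pi_pos])
  have p1 : 0 < Real.Gamma H := Real.Gamma_pos_of_pos h0
  have p2 : 0 < Real.Gamma (H + 1/2) := Real.Gamma_pos_of_pos (by linarith)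
  have p3 : 0 < Real.Gamma (2 * H) := Real.Gamma_pos_of_pos (by linarith)
  have p5 : 0 < √Real.pi := Real.sqrt_pos.2 Real.pi_pos
  have p6 : √Real.pi ^ 2 = Real.pi := Real.sq_sqrt Real.pi_pos.le
  have p7 : 0 < a ^ (-(2 * H)) := by positivity
  rw [CC, ProbabilityTheory.beta, g3, g4, g5]
  have g1' : Real.Gamma (1 - H) = √Real.pi ^ 2 / (Real.sin (Real.pi * H) * Real.Gamma H) := by
    rw [p6, eq_div_iff (by positivity)]
    rw [eq_div_iff hs.ne'] at g1
    linarith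
  have g2' : (2:ℝ) ^ (1 - 2 * H) = Real.Gamma H * Real.Gamma (H + 1/2) / (Real.Gamma (2 * H) * √Real.pi) := by
    rw [eq_div_iff (by positivity)]
    linarith
  rw [g1', g2']
  generalize Real.Gamma H = x at *
  generalize Real.Gamma (H + 1/2) = y at *
  generalize Real.Gamma (2 * H) = z at *
  generalize √Real.pi = w at *
  generalize Real.sin (Real.pi * H) = u at *
  generalize a ^ (-(2 * H)) = v at *
  field_simp
  try ring

lemma k_eq (H a t : ℝ) (ha : 0 < a) (ht : 0 < t)
    (hi : Integrable (fun s => pp H (t - s) - pp H t) (mu a)) :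
    ∫ s, (pp H (t - s) - pp H t) ∂(mu a) =
      -(t ^ (H - 1/2) - a * ∫ s in Set.Ioc (0:ℝ) t, (t - s) ^ (H - 1/2) * Real.exp (-a * s)) := by
  have hprob := mu_prob a ha
  have hi2 : Integrable (fun s => pp H (t - s)) (mu a) := by
    have := hi.add (integrable_const (pp H t))
    refine this.congr (Filter.Eventually.of_forall fun s => ?_)
    simp
  rw [integral_sub hi2 (integrable_const _)]
  simp only [integral_const, probReal_univ, smul_eq_mul, one_mul]
  have : ∫ s, pp H (t - s) ∂(mu a) =
      a * ∫ s in Set.Ioc (0:ℝ) t, (t - s) ^ (H - 1/2) * Real.exp (-a * s) := by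
    rw [mu, integral_withDensity_eq_integral_toReal_smul (by fun_prop)
      (Filter.Eventually.of_forall fun _ => ENNReal.ofReal_lt_top), integral_Ioc_eq_integral_Ioo,
      ← integral_const_mul, ← integral_indicator measurableSet_Ioi,
      ← integral_indicator measurableSet_Ioo]
    congr 1; ext s
    by_cases hs : 0 < s
    · rw [indicator_of_mem (show s ∈ Ioi 0 from hs), ENNReal.toReal_ofReal (by positivity), pp]
      by_cases hst : s < t
      · rw [indicator_of_mem (show s ∈ Ioo 0 t from ⟨hs, hst⟩), if_pos (by linarith), smul_eq_mul]
        ring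
      · rw [indicator_of_notMem (fun h => hst h.2), if_neg (by linarith), smul_zero]
    · rw [indicator_of_notMem (show s ∉ Ioi 0 from hs), indicator_of_notMem (fun h => hs h.1)]
  rw [this, pp, if_pos ht]; ring

/-- The `L²` norm of the fractional kernel equals the stationary variance of the fOU process:
`∫_0^∞ K(u)² du = (1/2) a^{-2H} / sin(πH)` for `H ∈ (0,1)`, `a > 0`. -/
theorem kernel_L2_norm_eq_variance (H a : ℝ) (hH : H ∈ Set.Ioo (0 : ℝ) 1) (ha : 0 < a)
    (K : ℝ → ℝ)
    (hK : ∀ t : ℝ, 0 < t → K t = (1 / Real.Gamma (H + 1/2)) *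
      (t ^ (H - 1/2) - a * ∫ s in Set.Ioc (0:ℝ) t, (t - s) ^ (H - 1/2) * Real.exp (-a * s))) :
    ∫ u in Set.Ioi (0 : ℝ), K u ^ 2 = a ^ (-(2 * H)) / (2 * Real.sin (Real.pi * H)) := by
  obtain ⟨h0, h1⟩ := hH
  have hpm := pp_meas H
  have hprob := mu_prob a ha
  obtain ⟨hint, hmain⟩ := main_k H a h0 h1 ha
  have hC := CC_pos H h0 h1
  have hG : 0 < Real.Gamma (2 * H + 1) := Real.Gamma_pos_of_pos (by linarith)
  set k : ℝ → ℝ := fun t => ∫ s, (pp H (t - s) - pp H t) ∂(mu a) with hk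
  have hkm : Measurable k := by
    have : StronglyMeasurable (fun z : ℝ × ℝ => pp H (z.1 - z.2) - pp H z.1) :=
      Measurable.stronglyMeasurable (by fun_prop)
    exact (this.integral_prod_right' (ν := mu a)).measurable
  have hk0 : ∀ t : ℝ, t ≤ 0 → k t = 0 := by
    intro t ht
    refine integral_eq_zero_of_ae ?_
    have : ∀ᵐ s ∂(mu a), s ∈ Ioi (0:ℝ) :=
      (withDensity_absolutelyContinuous _ _).ae_le (ae_restrict_mem measurableSet_Ioi)
    filter_upwards [this] with s hs
    have hs : 0 < s := hs
    simp [pp, show ¬ 0 < t by linarith, show ¬ s < t by linarith]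
  have e : ∫ u in Ioi (0:ℝ), K u ^ 2 = ∫ u in Ioi (0:ℝ), (1 / Real.Gamma (H + 1/2)) ^ 2 * k u ^ 2 := by
    refine setIntegral_congr_ae measurableSet_Ioi ?_
    filter_upwards [hint] with t ht htpos
    rw [hK t htpos, hk]
    simp only
    rw [k_eq H a t ha htpos ht]
    ring
  rw [e, integral_const_mul, ← gam H a h0 h1 ha]
  congr 1
  have e2 : ∫ u in Ioi (0:ℝ), k u ^ 2 = ∫ u, k u ^ 2 :=
    setIntegral_eq_integral_of_forall_compl_eq_zero fun t ht => by
      rw [hk0 t (not_lt.1 ht)]; norm_num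
  rw [e2, integral_eq_lintegral_of_nonneg_ae (Filter.Eventually.of_forall fun t => sq_nonneg _)
    (hkm.pow_const 2).aestronglyMeasurable, hmain, ENNReal.toReal_ofReal (by positivity)]
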